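/- arXiv:2211.13213 — 3 statements merged into one kernel-verified Lean document; each statement's English description precedes it below -/
import Mathlib

section
/- Let Ω ⊆ ℝ³ be open and star-shaped with star center x₀ ∈ Ω (i.e. for every x ∈ Ω the segment from x₀ to x lies in Ω). Let a : Ω → ℝ³ be continuously differentiable with curl a = 0 on Ω. Define f : Ω → ℝ by f(x) = ∫₀¹ ⟨a(x₀ + t(x − x₀)), x − x₀⟩ dt. Then f is continuously differentiable on Ω and grad f = a on Ω. -/
open MeasureTheory

noncomputable section

/-- The `i`-th partial derivative of `f : ℝ³ → ℝ`. -/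
def pd (i : Fin 3) (f : (Fin 3 → ℝ) → ℝ) (x : Fin 3 → ℝ) : ℝ :=
  fderiv ℝ f x (Pi.single i 1)

/-- Gradient of a scalar field on ℝ³. -/
def grad3 (f : (Fin 3 → ℝ) → ℝ) (x : Fin 3 → ℝ) : Fin 3 → ℝ :=
  fun i => pd i f x

/-- Curl of a vector field on ℝ³. -/
def curl3 (a : (Fin 3 → ℝ) → (Fin 3 → ℝ)) (x : Fin 3 → ℝ) : Fin 3 → ℝ :=
  ![pd 1 (fun y => a y 2) x - pd 2 (fun y => a y 1) x,
    pd 2 (fun y => a y 0) x - pd 0 (fun y => a y 2) x,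
    pd 0 (fun y => a y 1) x - pd 1 (fun y => a y 0) x]

/-- Divergence of a vector field on ℝ³. -/
def div3 (b : (Fin 3 → ℝ) → (Fin 3 → ℝ)) (x : Fin 3 → ℝ) : ℝ :=
  pd 0 (fun y => b y 0) x + pd 1 (fun y => b y 1) x + pd 2 (fun y => b y 2) x

/-- Euclidean inner product on ℝ³. -/
def dot3 (u w : Fin 3 → ℝ) : ℝ := ∑ i, u i * w i

/-- Cross product on ℝ³. -/
def cross3 (u w : Fin 3 → ℝ) : Fin 3 → ℝ :=
  ![u 1 * w 2 - u 2 * w 1, u 2 * w 0 - u 0 * w 2, u 0 * w 1 - u 1 * w 0]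

open Set in
/-- **Poincaré lemma** for closed `1`-forms on an open star-shaped set: integrating the form along
the segments issuing from the center gives a primitive. -/
theorem StarConvex.hasFDerivAt_integral_of_fderiv_symmetric
    {E : Type*} [NormedAddCommGroup E] [NormedSpace ℝ E] [ProperSpace E]
    {F : Type*} [NormedAddCommGroup F] [NormedSpace ℝ F] [CompleteSpace F]
    {ω : E → E →L[ℝ] F} {s : Set E} {c x : E} (hs : StarConvex ℝ c s) (hso : IsOpen s)
    (hω : ContDiffOn ℝ 1 ω s) (hsymm : ∀ y ∈ s, ∀ u v, fderiv ℝ ω y u v = fderiv ℝ ω y v u)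
    (hx : x ∈ s) :
    HasFDerivAt (fun y ↦ ∫ t in (0 : ℝ)..1, ω (c + t • (y - c)) (y - c)) (ω x) x := by
  set G : E → ℝ → E →L[ℝ] F := fun y t ↦
    t • fderiv ℝ ω (c + t • (y - c)) (y - c) + ω (c + t • (y - c)) with hG
  have hmaps : MapsTo (fun p : E × ℝ ↦ c + p.2 • (p.1 - c)) (s ×ˢ Icc 0 1) s :=
    fun p hp ↦ hs.add_smul_sub_mem hp.1 hp.2.1 hp.2.2
  have hω' : ∀ y ∈ s, HasFDerivAt ω (fderiv ℝ ω y) y := fun y hy ↦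
    ((hω.differentiableOn one_ne_zero).differentiableAt (hso.mem_nhds hy)).hasFDerivAt
  have hωcont : ContinuousOn (fun p : E × ℝ ↦ ω (c + p.2 • (p.1 - c))) (s ×ˢ Icc 0 1) :=
    hω.continuousOn.comp (by fun_prop) hmaps
  have hdωcont : ContinuousOn (fun p : E × ℝ ↦ fderiv ℝ ω (c + p.2 • (p.1 - c)))
      (s ×ˢ Icc 0 1) :=
    (hω.continuousOn_fderiv_of_isOpen hso le_rfl).comp (by fun_prop) hmaps
  have hGcont : ContinuousOn (fun p : E × ℝ ↦ G p.1 p.2) (s ×ˢ Icc 0 1) :=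
    (continuousOn_snd.smul (hdωcont.clm_apply (by fun_prop))).add hωcont
  have hslice : ∀ y ∈ s, MapsTo (fun t : ℝ ↦ (y, t)) (Icc 0 1) (s ×ˢ Icc 0 1) :=
    fun y hy t ht ↦ ⟨hy, ht⟩
  have hint : ∀ y ∈ s, IntervalIntegrable (fun t ↦ ω (c + t • (y - c)) (y - c)) volume 0 1 := by
    intro y hy
    refine ContinuousOn.intervalIntegrable_of_Icc zero_le_one ?_
    exact (hωcont.comp (by fun_prop) (hslice y hy)).clm_apply continuousOn_const
  have hGint : IntervalIntegrable (G x) volume 0 1 :=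
    ContinuousOn.intervalIntegrable_of_Icc zero_le_one
      (hGcont.comp (f := fun t : ℝ ↦ (x, t)) (by fun_prop) (hslice x hx))
  obtain ⟨δ, hδ, hball⟩ := Metric.nhds_basis_closedBall.mem_iff.1 (hso.mem_nhds hx)
  obtain ⟨C, hC⟩ := ((isCompact_closedBall x δ).prod isCompact_Icc).exists_bound_of_continuousOn
    (hGcont.mono (prod_mono_left hball))
  have hderiv : ∀ y ∈ s, ∀ t ∈ Icc (0 : ℝ) 1,
      HasFDerivAt (fun y ↦ ω (c + t • (y - c)) (y - c)) (G y t) y := by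
    intro y hy t ht
    have hmem : c + t • (y - c) ∈ s := hmaps (x := (y, t)) ⟨hy, ht⟩
    have hsub : HasFDerivAt (fun y ↦ y - c) (.id ℝ E) y := (hasFDerivAt_id y).sub_const c
    have hcomp := (hω' _ hmem).comp y ((hsub.const_smul t).const_add c)
    refine (hcomp.clm_apply hsub).congr_fderiv ?_
    ext v
    simp [hG, hsymm _ hmem v, add_comm]
  have hmain := intervalIntegral.hasFDerivAt_integral_of_dominated_of_fderiv_le (μ := volume)
    (a := 0) (b := 1) (F := fun y t ↦ ω (c + t • (y - c)) (y - c)) (F' := G)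
    (bound := fun _ ↦ C) (Metric.closedBall_mem_nhds x hδ)
    (by
      filter_upwards [hso.mem_nhds hx] with y hy
      rw [uIoc_of_le zero_le_one]
      exact (hint y hy).1.aestronglyMeasurable)
    (hint x hx)
    (by
      rw [uIoc_of_le zero_le_one]
      exact hGint.1.aestronglyMeasurable)
    (.of_forall fun t ht y hy ↦ by
      rw [uIoc_of_le zero_le_one] at ht
      exact hC (y, t) ⟨hy, Ioc_subset_Icc_self ht⟩)
    intervalIntegrable_const
    (.of_forall fun t ht y hy ↦ by
      rw [uIoc_of_le zero_le_one] at ht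
      exact hderiv y (hball hy) t (Ioc_subset_Icc_self ht))
  refine hmain.congr_fderiv ?_
  have hprim : ∀ t ∈ uIcc (0 : ℝ) 1, HasDerivAt (fun t : ℝ ↦ t • ω (c + t • (x - c))) (G x t) t := by
    intro t ht
    rw [uIcc_of_le zero_le_one] at ht
    have hline : HasDerivAt (fun t : ℝ ↦ c + t • (x - c)) (x - c) t := by
      simpa using ((hasDerivAt_id t).smul_const (x - c)).const_add c
    have hmem : c + t • (x - c) ∈ s := hmaps (x := (x, t)) ⟨hx, ht⟩
    refine ((hasDerivAt_id t).smul ((hω' _ hmem).comp_hasDerivAt t hline)).congr_deriv ?_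
    simp [hG]
  rw [intervalIntegral.integral_eq_sub_of_hasDerivAt hprim hGint]
  simp

/-- The inner product of ℝ³ as a continuous linear map from vectors to covectors. -/
def dot3CLM : (Fin 3 → ℝ) →L[ℝ] (Fin 3 → ℝ) →L[ℝ] ℝ :=
  ∑ i, (ContinuousLinearMap.proj (R := ℝ) (φ := fun _ : Fin 3 ↦ ℝ) i).smulRight
    (ContinuousLinearMap.proj (R := ℝ) (φ := fun _ : Fin 3 ↦ ℝ) i)

theorem dot3CLM_apply (u w : Fin 3 → ℝ) : dot3CLM u w = dot3 u w := by
  simp [dot3CLM, dot3]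

theorem fderiv_apply_eq_sum_pd {a : (Fin 3 → ℝ) → (Fin 3 → ℝ)} {x : Fin 3 → ℝ}
    (ha : DifferentiableAt ℝ a x) (u : Fin 3 → ℝ) (i : Fin 3) :
    fderiv ℝ a x u i = ∑ j, u j * pd j (fun y ↦ a y i) x := by
  have hcomp : fderiv ℝ (fun y ↦ a y i) x u = fderiv ℝ a x u i := by
    rw [fderiv_apply ha]
    rfl
  rw [← hcomp]
  conv_lhs => rw [pi_eq_sum_univ' u]
  simp [pd]

/-- The derivative of a curl-free vector field is symmetric. -/
theorem dot3_fderiv_comm_of_curl3_eq_zero {a : (Fin 3 → ℝ) → (Fin 3 → ℝ)} {x : Fin 3 → ℝ}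
    (ha : DifferentiableAt ℝ a x) (hcurl : curl3 a x = 0) (u v : Fin 3 → ℝ) :
    dot3 (fderiv ℝ a x u) v = dot3 (fderiv ℝ a x v) u := by
  have h0 := congrFun hcurl 0
  have h1 := congrFun hcurl 1
  have h2 := congrFun hcurl 2
  simp only [curl3, Matrix.cons_val, Pi.zero_apply] at h0 h1 h2
  simp only [dot3, fderiv_apply_eq_sum_pd ha, Fin.sum_univ_three]
  linear_combination (u 1 * v 2 - u 2 * v 1) * h0 + (u 2 * v 0 - u 0 * v 2) * h1 +
    (u 0 * v 1 - u 1 * v 0) * h2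

/-- Poincaré lemma, gradient case, explicit potential. -/
theorem statement0 (Ω : Set (Fin 3 → ℝ)) (hΩ : IsOpen Ω)
    (x₀ : Fin 3 → ℝ) (hx₀ : x₀ ∈ Ω)
    (hstar : ∀ x ∈ Ω, ∀ t ∈ Set.Icc (0:ℝ) 1, x₀ + t • (x - x₀) ∈ Ω)
    (a : (Fin 3 → ℝ) → (Fin 3 → ℝ)) (ha : ContDiffOn ℝ 1 a Ω)
    (hcurl : ∀ x ∈ Ω, curl3 a x = 0)
    (f : (Fin 3 → ℝ) → ℝ)
    (hf : ∀ x ∈ Ω, f x = ∫ t in (0:ℝ)..1, dot3 (a (x₀ + t • (x - x₀))) (x - x₀)) :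
    ContDiffOn ℝ 1 f Ω ∧ ∀ x ∈ Ω, grad3 f x = a x := by
  have hstarConvex : StarConvex ℝ x₀ Ω := by
    intro y hy r t hr ht hrt
    convert hstar y hy t ⟨ht, by linarith⟩ using 1
    rw [← eq_sub_iff_add_eq] at hrt
    rw [hrt]
    module
  have hω : ContDiffOn ℝ 1 (fun y ↦ dot3CLM (a y)) Ω := dot3CLM.contDiff.comp_contDiffOn ha
  have hsymm : ∀ y ∈ Ω, ∀ u v, fderiv ℝ (fun y ↦ dot3CLM (a y)) y u v =
      fderiv ℝ (fun y ↦ dot3CLM (a y)) y v u := by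
    intro y hy u v
    have hay := (ha.differentiableOn one_ne_zero).differentiableAt (hΩ.mem_nhds hy)
    have hfderiv := (dot3CLM.hasFDerivAt.comp y hay.hasFDerivAt).fderiv
    simp only [Function.comp_def] at hfderiv
    simpa only [hfderiv, ContinuousLinearMap.comp_apply, dot3CLM_apply] using
      dot3_fderiv_comm_of_curl3_eq_zero hay (hcurl y hy) u v
  have hderiv : ∀ x ∈ Ω, HasFDerivAt f (dot3CLM (a x)) x := by
    intro x hx
    refine (hstarConvex.hasFDerivAt_integral_of_fderiv_symmetric hΩ hω hsymm
      hx).congr_of_eventuallyEq ?_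
    filter_upwards [hΩ.mem_nhds hx] with y hy
    simp only [hf y hy, dot3CLM_apply]
  refine ⟨?_, fun x hx ↦ ?_⟩
  · rw [← zero_add (1 : WithTop ℕ∞), contDiffOn_succ_iff_fderiv_of_isOpen hΩ]
    refine ⟨fun x hx ↦ (hderiv x hx).differentiableAt.differentiableWithinAt, by simp, ?_⟩
    exact (hω.of_le zero_le_one).congr fun x hx ↦ (hderiv x hx).fderiv
  · ext i
    simp [grad3, pd, (hderiv x hx).fderiv, dot3CLM_apply, dot3, Pi.single_apply]
end
end

section
/- Let Ω ⊆ ℝ³ be open and star-shaped with star center x₀ ∈ Ω. Let b : Ω → ℝ³ be continuously differentiable with div b = 0 on Ω. Define a : Ω → ℝ³ by a(x) = (∫₀¹ t · b(x₀ + t(x − x₀)) dt) × (x − x₀), where × is the cross product on ℝ³. Then a is continuously differentiable on Ω and curl a = b on Ω. -/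
open MeasureTheory

noncomputable section

open Set Filter Topology

section ParametricIntegral

variable {H E : Type*} [NormedAddCommGroup H]
  [NormedAddCommGroup E] {Ω : Set H} {G : H → ℝ → E}

theorem exists_nhds_norm_le_of_continuousOn_prod_Icc [ProperSpace H] (hΩ : IsOpen Ω)
    (hG : ContinuousOn (Function.uncurry G) (Ω ×ˢ Icc (0 : ℝ) 1)) {x : H} (hx : x ∈ Ω) :
    ∃ s ∈ 𝓝 x, s ⊆ Ω ∧ ∃ C : ℝ, ∀ y ∈ s, ∀ t ∈ Icc (0 : ℝ) 1, ‖G y t‖ ≤ C := by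
  obtain ⟨r, hr, hsub⟩ := Metric.nhds_basis_closedBall.mem_iff.1 (hΩ.mem_nhds hx)
  obtain ⟨C, hC⟩ := ((isCompact_closedBall x r).prod isCompact_Icc).exists_bound_of_continuousOn
    (hG.mono (prod_mono_left hsub))
  exact ⟨_, Metric.closedBall_mem_nhds x hr, hsub, C, fun y hy t ht => hC (y, t) ⟨hy, ht⟩⟩

theorem continuousOn_section_of_continuousOn_prod_Icc
    (hG : ContinuousOn (Function.uncurry G) (Ω ×ˢ Icc (0 : ℝ) 1)) {x : H} (hx : x ∈ Ω) :
    ContinuousOn (G x) (Icc 0 1) :=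
  hG.comp (f := fun t : ℝ => (x, t)) (by fun_prop) fun _ ht => ⟨hx, ht⟩

theorem aestronglyMeasurable_section_of_continuousOn_prod_Icc
    (hG : ContinuousOn (Function.uncurry G) (Ω ×ˢ Icc (0 : ℝ) 1)) {x : H} (hx : x ∈ Ω) :
    AEStronglyMeasurable (G x) (volume.restrict (uIoc 0 1)) := by
  rw [uIoc_of_le zero_le_one]
  exact ((continuousOn_section_of_continuousOn_prod_Icc hG hx).mono
    Ioc_subset_Icc_self).aestronglyMeasurable measurableSet_Ioc

theorem uIoc_zero_one_subset_Icc : uIoc (0 : ℝ) 1 ⊆ Icc 0 1 := by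
  rw [uIoc_of_le zero_le_one]; exact Ioc_subset_Icc_self

variable [NormedSpace ℝ E]

theorem continuousOn_intervalIntegral_of_continuousOn_prod_Icc [ProperSpace H]
    (hΩ : IsOpen Ω)
    (hG : ContinuousOn (Function.uncurry G) (Ω ×ˢ Icc (0 : ℝ) 1)) :
    ContinuousOn (fun x => ∫ t in (0 : ℝ)..1, G x t) Ω := by
  intro x hx
  obtain ⟨s, hs, hsΩ, C, hC⟩ := exists_nhds_norm_le_of_continuousOn_prod_Icc hΩ hG hx
  refine (intervalIntegral.continuousAt_of_dominated_interval (bound := fun _ => C) ?_ ?_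
    intervalIntegrable_const ?_).continuousWithinAt
  · filter_upwards [hs] with y hy
    exact aestronglyMeasurable_section_of_continuousOn_prod_Icc hG (hsΩ hy)
  · filter_upwards [hs] with y hy
    exact .of_forall fun t ht => hC y hy t (uIoc_zero_one_subset_Icc ht)
  · refine .of_forall fun t ht => ?_
    have : ContinuousOn (fun y => G y t) Ω :=
      hG.comp (f := fun y => (y, t)) (by fun_prop)
        fun _ hy => ⟨hy, uIoc_zero_one_subset_Icc ht⟩
    exact this.continuousAt (hΩ.mem_nhds hx)

theorem hasFDerivAt_intervalIntegral_of_continuousOn_prod_Icc [ProperSpace H] [NormedSpace ℝ H]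
    (hΩ : IsOpen Ω)
    {G' : H → ℝ → H →L[ℝ] E}
    (hG : ContinuousOn (Function.uncurry G) (Ω ×ˢ Icc (0 : ℝ) 1))
    (hG' : ContinuousOn (Function.uncurry G') (Ω ×ˢ Icc (0 : ℝ) 1))
    (hderiv : ∀ x ∈ Ω, ∀ t ∈ Icc (0 : ℝ) 1, HasFDerivAt (fun y => G y t) (G' x t) x)
    {x : H} (hx : x ∈ Ω) :
    HasFDerivAt (fun y => ∫ t in (0 : ℝ)..1, G y t) (∫ t in (0 : ℝ)..1, G' x t) x := by
  obtain ⟨s, hs, hsΩ, C, hC⟩ := exists_nhds_norm_le_of_continuousOn_prod_Icc hΩ hG' hx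
  refine intervalIntegral.hasFDerivAt_integral_of_dominated_of_fderiv_le (bound := fun _ => C) hs
    ?_ ?_ (aestronglyMeasurable_section_of_continuousOn_prod_Icc hG' hx) ?_
    intervalIntegrable_const ?_
  · filter_upwards [hs] with y hy
    exact aestronglyMeasurable_section_of_continuousOn_prod_Icc hG (hsΩ hy)
  · exact (continuousOn_section_of_continuousOn_prod_Icc hG hx).intervalIntegrable_of_Icc
      zero_le_one
  · exact .of_forall fun t ht y hy => hC y hy t (uIoc_zero_one_subset_Icc ht)
  · exact .of_forall fun t ht y hy => hderiv y (hsΩ hy) t (uIoc_zero_one_subset_Icc ht)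

end ParametricIntegral

section RadialMoment

variable {H E : Type*} [NormedAddCommGroup H] [NormedSpace ℝ H]
  [NormedAddCommGroup E] [NormedSpace ℝ E]
  {Ω : Set H} {x₀ : H} {b : H → E}

theorem continuousOn_comp_segment {F : Type*} [TopologicalSpace F] {f : H → F}
    (hstar : ∀ x ∈ Ω, ∀ t ∈ Icc (0 : ℝ) 1, x₀ + t • (x - x₀) ∈ Ω) (hf : ContinuousOn f Ω) :
    ContinuousOn (fun p : H × ℝ => f (x₀ + p.2 • (p.1 - x₀))) (Ω ×ˢ Icc (0 : ℝ) 1) :=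
  hf.comp (f := fun p : H × ℝ => x₀ + p.2 • (p.1 - x₀)) (by fun_prop)
    fun p hp => hstar p.1 hp.1 p.2 hp.2

theorem continuousOn_radialMoment_deriv (hΩ : IsOpen Ω)
    (hstar : ∀ x ∈ Ω, ∀ t ∈ Icc (0 : ℝ) 1, x₀ + t • (x - x₀) ∈ Ω) (hb : ContDiffOn ℝ 1 b Ω) :
    ContinuousOn (Function.uncurry fun x (t : ℝ) => t ^ 2 • fderiv ℝ b (x₀ + t • (x - x₀)))
      (Ω ×ˢ Icc (0 : ℝ) 1) :=
  (continuous_snd.pow 2).continuousOn.smul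
    (continuousOn_comp_segment hstar (hb.continuousOn_fderiv_of_isOpen hΩ le_rfl))

theorem hasFDerivAt_radialMoment [ProperSpace H] (hΩ : IsOpen Ω)
    (hstar : ∀ x ∈ Ω, ∀ t ∈ Icc (0 : ℝ) 1, x₀ + t • (x - x₀) ∈ Ω) (hb : ContDiffOn ℝ 1 b Ω)
    {x : H} (hx : x ∈ Ω) :
    HasFDerivAt (fun y => ∫ t in (0 : ℝ)..1, t • b (x₀ + t • (y - x₀)))
      (∫ t in (0 : ℝ)..1, t ^ 2 • fderiv ℝ b (x₀ + t • (x - x₀))) x := by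
  refine hasFDerivAt_intervalIntegral_of_continuousOn_prod_Icc hΩ
    (G := fun y (t : ℝ) => t • b (x₀ + t • (y - x₀)))
    (continuous_snd.continuousOn.smul (continuousOn_comp_segment hstar hb.continuousOn))
    (continuousOn_radialMoment_deriv hΩ hstar hb) (fun y hy t ht => ?_) hx
  have hbt := ((hb.differentiableOn one_ne_zero).differentiableAt
    (hΩ.mem_nhds (hstar y hy t ht))).hasFDerivAt
  have hseg : HasFDerivAt (fun z : H => x₀ + t • (z - x₀)) (t • ContinuousLinearMap.id ℝ H) y :=
    (((hasFDerivAt_id y).sub_const x₀).const_smul t).const_add x₀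
  refine ((hbt.comp y hseg).const_smul t).congr_fderiv ?_
  ext v
  simp [pow_two, mul_smul]

theorem contDiffOn_radialMoment [ProperSpace H] (hΩ : IsOpen Ω)
    (hstar : ∀ x ∈ Ω, ∀ t ∈ Icc (0 : ℝ) 1, x₀ + t • (x - x₀) ∈ Ω) (hb : ContDiffOn ℝ 1 b Ω) :
    ContDiffOn ℝ 1 (fun y => ∫ t in (0 : ℝ)..1, t • b (x₀ + t • (y - x₀))) Ω := by
  have hA := fun x (hx : x ∈ Ω) => hasFDerivAt_radialMoment hΩ hstar hb hx
  rw [← zero_add (1 : WithTop ℕ∞), contDiffOn_succ_iff_fderiv_of_isOpen hΩ]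
  refine ⟨fun x hx => (hA x hx).differentiableAt.differentiableWithinAt, by simp, ?_⟩
  rw [contDiffOn_zero]
  exact (continuousOn_intervalIntegral_of_continuousOn_prod_Icc hΩ
    (continuousOn_radialMoment_deriv hΩ hstar hb)).congr fun x hx => (hA x hx).fderiv

theorem two_smul_radialMoment_add_deriv [CompleteSpace E] (hΩ : IsOpen Ω)
    (hstar : ∀ x ∈ Ω, ∀ t ∈ Icc (0 : ℝ) 1, x₀ + t • (x - x₀) ∈ Ω) (hb : ContDiffOn ℝ 1 b Ω)
    {x : H} (hx : x ∈ Ω) :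
    (2 : ℝ) • (∫ t in (0 : ℝ)..1, t • b (x₀ + t • (x - x₀)))
      + (∫ t in (0 : ℝ)..1, t ^ 2 • fderiv ℝ b (x₀ + t • (x - x₀))) (x - x₀) = b x := by
  have hf' : ContinuousOn (fun t : ℝ => t ^ 2 • fderiv ℝ b (x₀ + t • (x - x₀))) (Icc 0 1) :=
    continuousOn_section_of_continuousOn_prod_Icc
      (continuousOn_radialMoment_deriv hΩ hstar hb) hx
  have hf : ContinuousOn (fun t : ℝ => t • b (x₀ + t • (x - x₀))) (Icc 0 1) :=
    continuousOn_id.smul (hb.continuousOn.comp (f := fun t : ℝ => x₀ + t • (x - x₀))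
      (by fun_prop) fun t ht => hstar x hx t ht)
  have hf'x := hf'.clm_apply (continuousOn_const (c := x - x₀))
  have hderiv : ∀ t ∈ uIcc (0 : ℝ) 1, HasDerivAt (fun t : ℝ => t ^ 2 • b (x₀ + t • (x - x₀)))
      ((2 : ℝ) • t • b (x₀ + t • (x - x₀))
        + (t ^ 2 • fderiv ℝ b (x₀ + t • (x - x₀))) (x - x₀)) t := by
    intro t ht
    rw [uIcc_of_le zero_le_one] at ht
    have hbt := ((hb.differentiableOn one_ne_zero).differentiableAt
      (hΩ.mem_nhds (hstar x hx t ht))).hasFDerivAt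
    have hseg : HasDerivAt (fun t : ℝ => x₀ + t • (x - x₀)) (x - x₀) t := by
      simpa using ((hasDerivAt_id t).smul_const (x - x₀)).const_add x₀
    refine ((hasDerivAt_pow 2 t).smul (hbt.comp_hasDerivAt t hseg)).congr_deriv ?_
    simp [mul_smul, add_comm]
  have hint : IntervalIntegrable (fun t : ℝ => (2 : ℝ) • t • b (x₀ + t • (x - x₀))) volume 0 1 :=
    (hf.const_smul (2 : ℝ)).intervalIntegrable_of_Icc zero_le_one
  have hint' := hf'x.intervalIntegrable_of_Icc (μ := volume) zero_le_one
  have hftc := intervalIntegral.integral_eq_sub_of_hasDerivAt hderiv (hint.add hint')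
  rw [intervalIntegral.integral_add hint hint', intervalIntegral.integral_smul] at hftc
  rw [ContinuousLinearMap.intervalIntegral_apply
    (hf'.intervalIntegrable_of_Icc zero_le_one), hftc]
  simp

end RadialMoment

theorem pd_apply_eq {f : (Fin 3 → ℝ) → Fin 3 → ℝ} {f' : (Fin 3 → ℝ) →L[ℝ] Fin 3 → ℝ}
    {x : Fin 3 → ℝ} (hf : HasFDerivAt f f' x) (i j : Fin 3) :
    pd i (fun y => f y j) x = f' (Pi.single i 1) j := by
  rw [pd, (hasFDerivAt_pi'.1 hf j).fderiv]
  rfl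

/-- The partial derivatives of a component of `y ↦ cross3 (A y) (y - x₀)`. -/
theorem pd_cross_component {A : (Fin 3 → ℝ) → Fin 3 → ℝ} {A' : (Fin 3 → ℝ) →L[ℝ] Fin 3 → ℝ}
    {x : Fin 3 → ℝ} (hA : HasFDerivAt A A' x) (x₀ : Fin 3 → ℝ) (i j l : Fin 3) :
    pd l (fun y => A y i * (y - x₀) j - A y j * (y - x₀) i) x =
      A' (Pi.single l 1) i * (x - x₀) j + A x i * (Pi.single l 1 : Fin 3 → ℝ) j
        - (A' (Pi.single l 1) j * (x - x₀) i + A x j * (Pi.single l 1 : Fin 3 → ℝ) i) := by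
  have hAc := hasFDerivAt_pi'.1 hA
  have hid := hasFDerivAt_pi'.1 (show HasFDerivAt (fun y => y - x₀)
    (ContinuousLinearMap.id ℝ (Fin 3 → ℝ)) x from (hasFDerivAt_id x).sub_const x₀)
  have h : HasFDerivAt (fun y => A y i * (y - x₀) j - A y j * (y - x₀) i) _ x :=
    ((hAc i).mul (hid j)).sub ((hAc j).mul (hid i))
  rw [pd, h.fderiv]
  simp
  ring

theorem curl3_cross3_sub {A : (Fin 3 → ℝ) → Fin 3 → ℝ} {A' : (Fin 3 → ℝ) →L[ℝ] Fin 3 → ℝ}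
    {x : Fin 3 → ℝ} (hA : HasFDerivAt A A' x) (x₀ : Fin 3 → ℝ) :
    curl3 (fun y => cross3 (A y) (y - x₀)) x =
      (2 : ℝ) • A x + A' (x - x₀) - div3 A x • (x - x₀) := by
  have hexp : ∀ k, A' (x - x₀) k = ∑ i, (x - x₀) i * A' (Pi.single i 1) k := fun k => by
    conv_lhs => rw [pi_eq_sum_univ' (x - x₀)]
    simp [Finset.sum_apply]
  have h0 := pd_cross_component hA x₀ 1 2
  have h1 := pd_cross_component hA x₀ 2 0
  have h2 := pd_cross_component hA x₀ 0 1
  ext k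
  simp only [Pi.sub_apply, Pi.add_apply, Pi.smul_apply, hexp, Fin.sum_univ_three, div3,
    pd_apply_eq hA]
  fin_cases k <;> simp [curl3, cross3] at h0 h1 h2 ⊢ <;> simp [h0, h1, h2] <;> ring

/-- Poincaré lemma, curl case, explicit vector potential. -/
theorem statement2 (Ω : Set (Fin 3 → ℝ)) (hΩ : IsOpen Ω)
    (x₀ : Fin 3 → ℝ) (hx₀ : x₀ ∈ Ω)
    (hstar : ∀ x ∈ Ω, ∀ t ∈ Set.Icc (0:ℝ) 1, x₀ + t • (x - x₀) ∈ Ω)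
    (b : (Fin 3 → ℝ) → (Fin 3 → ℝ)) (hb : ContDiffOn ℝ 1 b Ω)
    (hdiv : ∀ x ∈ Ω, div3 b x = 0)
    (a : (Fin 3 → ℝ) → (Fin 3 → ℝ))
    (ha : ∀ x ∈ Ω,
      a x = cross3 (∫ t in (0:ℝ)..1, t • b (x₀ + t • (x - x₀))) (x - x₀)) :
    ContDiffOn ℝ 1 a Ω ∧ ∀ x ∈ Ω, curl3 a x = b x := by
  set A : (Fin 3 → ℝ) → Fin 3 → ℝ := fun y => ∫ t in (0 : ℝ)..1, t • b (x₀ + t • (y - x₀))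
  have hA := fun x (hx : x ∈ Ω) => hasFDerivAt_radialMoment hΩ hstar hb hx
  refine ⟨?_, fun x hx => ?_⟩
  · refine ContDiffOn.congr (f := fun x => cross3 (A x) (x - x₀)) ?_ ha
    have hAc := contDiffOn_pi.1 (contDiffOn_radialMoment hΩ hstar hb)
    have hid := contDiffOn_pi.1 ((contDiff_id.sub contDiff_const).contDiffOn :
      ContDiffOn ℝ 1 (fun x : Fin 3 → ℝ => x - x₀) Ω)
    refine contDiffOn_pi.2 fun k => ?_
    fin_cases k
    exacts [((hAc 1).mul (hid 2)).sub ((hAc 2).mul (hid 1)),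
      ((hAc 2).mul (hid 0)).sub ((hAc 0).mul (hid 2)),
      ((hAc 0).mul (hid 1)).sub ((hAc 1).mul (hid 0))]
  · have hcurl : curl3 a x = curl3 (fun y => cross3 (A y) (y - x₀)) x := by
      have hev : ∀ k, (fun y => a y k) =ᶠ[𝓝 x] fun y => cross3 (A y) (y - x₀) k := fun k => by
        filter_upwards [hΩ.mem_nhds hx] with y hy
        rw [ha y hy]
      simp only [curl3, pd, (hev _).fderiv_eq]
    have hdivA : div3 A x = 0 := by
      have hf' : ContinuousOn (fun t : ℝ => t ^ 2 • fderiv ℝ b (x₀ + t • (x - x₀))) (Icc 0 1) :=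
        continuousOn_section_of_continuousOn_prod_Icc
          (continuousOn_radialMoment_deriv hΩ hstar hb) hx
      let L : ((Fin 3 → ℝ) →L[ℝ] Fin 3 → ℝ) →L[ℝ] ℝ := ∑ i : Fin 3,
        (ContinuousLinearMap.proj i).comp
          (ContinuousLinearMap.apply ℝ (Fin 3 → ℝ) (Pi.single i (1 : ℝ)))
      have hL : ∀ (f : (Fin 3 → ℝ) → Fin 3 → ℝ) f' y, HasFDerivAt f f' y → div3 f y = L f' :=
        fun f f' y hf => by
          simp [div3, pd_apply_eq hf, L, Fin.sum_univ_three]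
      rw [hL _ _ _ (hA x hx), ← L.intervalIntegral_comp_comm
        (hf'.intervalIntegrable_of_Icc zero_le_one)]
      refine intervalIntegral.integral_zero_ae (.of_forall fun t ht => ?_)
      have hy := hstar x hx t (uIoc_zero_one_subset_Icc ht)
      rw [map_smul, ← hL b _ _ ((hb.differentiableOn one_ne_zero).differentiableAt
        (hΩ.mem_nhds hy)).hasFDerivAt, hdiv _ hy, smul_zero]
    rw [hcurl, curl3_cross3_sub (hA x hx), hdivA, zero_smul, sub_zero]
    exact two_smul_radialMoment_add_deriv hΩ hstar hb hx
end
end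

section
/- Let Ω ⊆ ℝ³ be open and star-shaped with star center x₀ ∈ Ω. Let D : ℝ × Ω → ℝ³ be twice continuously differentiable, and let ρ : ℝ × Ω → ℝ and j : ℝ × Ω → ℝ³ be continuously differentiable, satisfying for all (t,x) ∈ ℝ × Ω: div D(t,·)|ₓ = ρ(t,x) (Gauss' law) and ∂ₜρ(t,x) + (div j(t,·))|ₓ = 0 (continuity equation for the electric current). Then there exists a vector field H : ℝ × Ω → ℝ³ such that for every t ∈ ℝ, H(t,·) is continuously differentiable on Ω and curl H(t,·) = ∂ₜD(t,·) + j(t,·) on Ω (Ampère's law with displacement current). -/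
open MeasureTheory

noncomputable section

open Set Filter Topology

section ParametricIntegral

theorem ContinuousOn.aestronglyMeasurable_uIoc {F : Type*} [NormedAddCommGroup F] {f : ℝ → F}
    (hf : ContinuousOn f (Icc 0 1)) :
    AEStronglyMeasurable f (volume.restrict (uIoc (0 : ℝ) 1)) := by
  rw [uIoc_of_le zero_le_one]
  exact (hf.aestronglyMeasurable measurableSet_Icc).mono_set Ioc_subset_Icc_self

variable {E F : Type*} [NormedAddCommGroup E] [NormedSpace ℝ E]
  [NormedAddCommGroup F] [NormedSpace ℝ F]

theorem HasFDerivAt.comp_prodMk_left {g : E × ℝ → F} {g' : E × ℝ →L[ℝ] F} {x : E} {s : ℝ}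
    (h : HasFDerivAt g g' (x, s)) :
    HasFDerivAt (fun y => g (y, s)) (g'.comp (ContinuousLinearMap.inl ℝ E ℝ)) x :=
  h.comp x (hasFDerivAt_prodMk_left x s)

/-- Differentiation under the integral sign for an integrand of class `C¹`. -/
theorem ContDiffOn.hasFDerivAt_intervalIntegral [LocallyCompactSpace E] {g : E × ℝ → F}
    {W : Set (E × ℝ)} {U : Set E} (hW : IsOpen W) (hU : IsOpen U)
    (hUW : U ×ˢ Icc (0 : ℝ) 1 ⊆ W) (hg : ContDiffOn ℝ 1 g W) :
    (∀ x ∈ U, HasFDerivAt (fun y => ∫ s in (0 : ℝ)..1, g (y, s))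
      (∫ s in (0 : ℝ)..1, (fderiv ℝ g (x, s)).comp (ContinuousLinearMap.inl ℝ E ℝ)) x) ∧
    ContinuousOn (fun x => ∫ s in (0 : ℝ)..1,
      (fderiv ℝ g (x, s)).comp (ContinuousLinearMap.inl ℝ E ℝ)) U := by
  have hg' : ContinuousOn (fun p => (fderiv ℝ g p).comp (ContinuousLinearMap.inl ℝ E ℝ)) W :=
    (hg.continuousOn_fderiv_of_isOpen hW le_rfl).clm_comp continuousOn_const
  have hslice {x : E} (hx : x ∈ U) : MapsTo (fun s : ℝ => (x, s)) (Icc 0 1) W :=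
    fun s hs => hUW ⟨hx, hs⟩
  have hpair (x : E) : ContinuousOn (fun s : ℝ => (x, s)) (Icc 0 1) := by fun_prop
  have hI : uIoc (0 : ℝ) 1 ⊆ Icc 0 1 := by
    rw [uIoc_of_le zero_le_one]; exact Ioc_subset_Icc_self
  have hbound : ∀ x ∈ U, ∃ K ∈ 𝓝 x, K ⊆ U ∧ ∃ C, ∀ y ∈ K, ∀ s ∈ Icc (0 : ℝ) 1,
      ‖(fderiv ℝ g (y, s)).comp (ContinuousLinearMap.inl ℝ E ℝ)‖ ≤ C := by
    intro x hx
    obtain ⟨K, hK, hKU, hKc⟩ := local_compact_nhds (hU.mem_nhds hx)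
    obtain ⟨C, hC⟩ := (hKc.prod (isCompact_Icc (a := (0 : ℝ)) (b := 1))).exists_bound_of_continuousOn
      (hg'.mono ((prod_mono_left hKU).trans hUW))
    exact ⟨K, hK, hKU, C, fun y hy s hs => hC (y, s) ⟨hy, hs⟩⟩
  refine ⟨fun x hx => ?_, fun x hx => ContinuousAt.continuousWithinAt ?_⟩ <;>
    obtain ⟨K, hK, hKU, C, hC⟩ := hbound x hx
  · refine intervalIntegral.hasFDerivAt_integral_of_dominated_of_fderiv_le
      (F' := fun y s => (fderiv ℝ g (y, s)).comp (ContinuousLinearMap.inl ℝ E ℝ))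
      (bound := fun _ => C) hK ?_ ?_ ?_ ?_ intervalIntegrable_const ?_
    · filter_upwards [hU.mem_nhds hx] with y hy
      exact (hg.continuousOn.comp (hpair y) (hslice hy)).aestronglyMeasurable_uIoc
    · refine ContinuousOn.intervalIntegrable ?_
      rw [uIcc_of_le zero_le_one]
      exact hg.continuousOn.comp (hpair x) (hslice hx)
    · exact (hg'.comp (hpair x) (hslice hx)).aestronglyMeasurable_uIoc
    · exact .of_forall fun s hs y hy => hC y hy s (hI hs)
    · exact .of_forall fun s hs y hy => ((hg.differentiableOn one_ne_zero).differentiableAt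
        (hW.mem_nhds (hslice (hKU hy) (hI hs)))).hasFDerivAt.comp_prodMk_left
  · refine intervalIntegral.continuousAt_of_dominated_interval
      (bound := fun _ => C) ?_ ?_ intervalIntegrable_const ?_
    · filter_upwards [hU.mem_nhds hx] with y hy
      exact (hg'.comp (hpair y) (hslice hy)).aestronglyMeasurable_uIoc
    · filter_upwards [hK] with y hy
      exact .of_forall fun s hs => hC y hy s (hI hs)
    · refine .of_forall fun s hs => ?_
      exact ContinuousAt.comp (f := fun y : E => (y, s))
        (hg'.continuousAt (hW.mem_nhds (hslice hx (hI hs)))) (by fun_prop)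

theorem ContDiffOn.contDiffOn_intervalIntegral [LocallyCompactSpace E] {g : E × ℝ → F}
    {W : Set (E × ℝ)} {U : Set E} (hW : IsOpen W) (hU : IsOpen U)
    (hUW : U ×ˢ Icc (0 : ℝ) 1 ⊆ W) (hg : ContDiffOn ℝ 1 g W) :
    ContDiffOn ℝ 1 (fun y => ∫ s in (0 : ℝ)..1, g (y, s)) U := by
  obtain ⟨hderiv, hcont⟩ := hg.hasFDerivAt_intervalIntegral hW hU hUW
  rw [← zero_add (1 : WithTop ℕ∞), contDiffOn_succ_iff_fderiv_of_isOpen hU, contDiffOn_zero]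
  exact ⟨fun x hx => (hderiv x hx).differentiableAt.differentiableWithinAt, by simp,
    hcont.congr fun x hx => (hderiv x hx).fderiv⟩

end ParametricIntegral

theorem pd_intervalIntegral {g : (Fin 3 → ℝ) × ℝ → ℝ} {W : Set ((Fin 3 → ℝ) × ℝ)}
    {U : Set (Fin 3 → ℝ)} (hW : IsOpen W) (hU : IsOpen U)
    (hUW : U ×ˢ Icc (0 : ℝ) 1 ⊆ W) (hg : ContDiffOn ℝ 1 g W)
    (k : Fin 3) {x : Fin 3 → ℝ} (hx : x ∈ U) :
    IntervalIntegrable (fun s => pd k (fun y => g (y, s)) x) volume 0 1 ∧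
    pd k (fun y => ∫ s in (0 : ℝ)..1, g (y, s)) x =
      ∫ s in (0 : ℝ)..1, pd k (fun y => g (y, s)) x := by
  have hmaps : MapsTo (fun s : ℝ => (x, s)) (uIcc 0 1) W := by
    rw [uIcc_of_le zero_le_one]; exact fun s hs => hUW ⟨hx, hs⟩
  have hcont : ContinuousOn
      (fun s => (fderiv ℝ g (x, s)).comp (ContinuousLinearMap.inl ℝ (Fin 3 → ℝ) ℝ))
      (uIcc (0 : ℝ) 1) :=
    ((hg.continuousOn_fderiv_of_isOpen hW le_rfl).comp (by fun_prop) hmaps).clm_comp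
      continuousOn_const
  have hpd : EqOn (fun s => pd k (fun y => g (y, s)) x)
      (fun s => (fderiv ℝ g (x, s)).comp (ContinuousLinearMap.inl ℝ (Fin 3 → ℝ) ℝ)
        (Pi.single k 1)) (uIcc (0 : ℝ) 1) := by
    intro s hs
    have h := ((hg.differentiableOn one_ne_zero).differentiableAt
      (hW.mem_nhds (hmaps hs))).hasFDerivAt.comp_prodMk_left
    simp only [pd, h.fderiv]
  constructor
  · exact ((hcont.clm_apply continuousOn_const).congr hpd).intervalIntegrable
  · rw [intervalIntegral.integral_congr hpd, pd,
      ((hg.hasFDerivAt_intervalIntegral hW hU hUW).1 x hx).fderiv,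
      ContinuousLinearMap.intervalIntegral_apply hcont.intervalIntegrable]

theorem pd_cross_radial {w : (Fin 3 → ℝ) → (Fin 3 → ℝ)} {x₀ x : Fin 3 → ℝ} {s : ℝ}
    (hw : ∀ i, DifferentiableAt ℝ (fun y => w y i) (x₀ + s • (x - x₀))) (k a b : Fin 3) :
    pd k (fun y => s * w (x₀ + s • (y - x₀)) a * (y b - x₀ b)
      - s * w (x₀ + s • (y - x₀)) b * (y a - x₀ a)) x =
    (s ^ 2 * pd k (fun y => w y a) (x₀ + s • (x - x₀)) * (x b - x₀ b)
        + s * w (x₀ + s • (x - x₀)) a * (Pi.single k 1 : Fin 3 → ℝ) b)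
      - (s ^ 2 * pd k (fun y => w y b) (x₀ + s • (x - x₀)) * (x a - x₀ a)
        + s * w (x₀ + s • (x - x₀)) b * (Pi.single k 1 : Fin 3 → ℝ) a) := by
  have hφ : HasFDerivAt (fun y : Fin 3 → ℝ => x₀ + s • (y - x₀))
      (s • ContinuousLinearMap.id ℝ (Fin 3 → ℝ)) x :=
    (((hasFDerivAt_id x).sub_const x₀).const_smul s).const_add x₀
  have hcoord (i : Fin 3) : HasFDerivAt (fun y : Fin 3 → ℝ => y i - x₀ i)
      (ContinuousLinearMap.proj (R := ℝ) (φ := fun _ : Fin 3 => ℝ) i) x :=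
    (ContinuousLinearMap.proj (R := ℝ) (φ := fun _ : Fin 3 => ℝ) i).hasFDerivAt.sub_const _
  have hwφ (i : Fin 3) := (((hw i).hasFDerivAt.comp x hφ).const_mul s)
  have h := ((hwφ a).mul (hcoord b)).sub ((hwφ b).mul (hcoord a))
  have e := congrArg (fun L => L (Pi.single k 1)) h.fderiv
  refine (Eq.trans ?_ e).trans ?_
  · rfl
  · simp [pd]
    ring

/-- The radial derivative identity behind the Poincaré lemma for divergence-free fields. -/
theorem hasDerivAt_sq_mul_radial {w : (Fin 3 → ℝ) → (Fin 3 → ℝ)} {x₀ x : Fin 3 → ℝ} {s : ℝ}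
    (hw : ∀ i, DifferentiableAt ℝ (fun y => w y i) (x₀ + s • (x - x₀)))
    (hdiv : div3 w (x₀ + s • (x - x₀)) = 0) (i : Fin 3) :
    HasDerivAt (fun r : ℝ => r ^ 2 * w (x₀ + r • (x - x₀)) i)
      (curl3 (fun y => cross3 (s • w (x₀ + s • (y - x₀))) (y - x₀)) x i) s := by
  have hφ : HasDerivAt (fun r : ℝ => x₀ + r • (x - x₀)) (x - x₀) s := by
    simpa using ((hasDerivAt_id s).smul_const (x - x₀)).const_add x₀
  have hmul := (hasDerivAt_pow 2 s).mul ((hw i).hasFDerivAt.comp_hasDerivAt s hφ)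
  refine hmul.congr_deriv ?_
  have hexp : x - x₀ = ∑ k, (x k - x₀ k) • (Pi.single k 1 : Fin 3 → ℝ) := by
    ext k
    fin_cases k <;> simp [Pi.single_apply]
  have hdir : fderiv ℝ (fun y => w y i) (x₀ + s • (x - x₀)) (x - x₀) =
      ∑ k, (x k - x₀ k) * pd k (fun y => w y i) (x₀ + s • (x - x₀)) := by
    conv_lhs => rw [hexp]
    simp only [map_sum, map_smul, smul_eq_mul, pd]
    rw [← hexp]
  rw [hdir]
  simp only [curl3, cross3, Pi.smul_apply, Pi.sub_apply, smul_eq_mul, Matrix.cons_val,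
    Matrix.cons_val_zero, Matrix.cons_val_one, pd_cross_radial hw]
  simp only [div3] at hdiv
  fin_cases i <;>
    simp [Fin.sum_univ_three]
  · linear_combination (s ^ 2 * (x 0 - x₀ 0)) * hdiv
  · linear_combination (s ^ 2 * (x 1 - x₀ 1)) * hdiv
  · linear_combination (s ^ 2 * (x 2 - x₀ 2)) * hdiv

/-- A divergence-free `C¹` field on an open star-shaped set is the curl of a `C¹` field. -/
theorem exists_curl3_eq_of_div3_eq_zero {Ω : Set (Fin 3 → ℝ)} (hΩ : IsOpen Ω)
    {x₀ : Fin 3 → ℝ} (hstar : ∀ x ∈ Ω, ∀ t ∈ Icc (0 : ℝ) 1, x₀ + t • (x - x₀) ∈ Ω)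
    {w : (Fin 3 → ℝ) → (Fin 3 → ℝ)} (hw : ContDiffOn ℝ 1 w Ω)
    (hdiv : ∀ x ∈ Ω, div3 w x = 0) :
    ∃ H : (Fin 3 → ℝ) → (Fin 3 → ℝ), ContDiffOn ℝ 1 H Ω ∧ ∀ x ∈ Ω, curl3 H x = w x := by
  let φ : (Fin 3 → ℝ) × ℝ → (Fin 3 → ℝ) := fun p => x₀ + p.2 • (p.1 - x₀)
  have hφ : ContDiff ℝ 1 φ := by fun_prop
  let g : Fin 3 → (Fin 3 → ℝ) × ℝ → ℝ := fun i p => cross3 (p.2 • w (φ p)) (p.1 - x₀) i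
  have hW : IsOpen (φ ⁻¹' Ω) := hΩ.preimage hφ.continuous
  have hUW : Ω ×ˢ Icc (0 : ℝ) 1 ⊆ φ ⁻¹' Ω := fun p hp => hstar p.1 hp.1 p.2 hp.2
  have hwi := contDiffOn_pi.1 hw
  have hwφ (i : Fin 3) : ContDiffOn ℝ 1 (fun p => w (φ p) i) (φ ⁻¹' Ω) :=
    (hwi i).comp hφ.contDiffOn (mapsTo_preimage _ _)
  have hterm (a b : Fin 3) :
      ContDiffOn ℝ 1 (fun p => p.2 * w (φ p) a * (p.1 b - x₀ b)) (φ ⁻¹' Ω) :=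
    (contDiff_snd.contDiffOn.mul (hwφ a)).mul (by fun_prop)
  have hg (i : Fin 3) : ContDiffOn ℝ 1 (g i) (φ ⁻¹' Ω) := by
    fin_cases i
    · exact (hterm 1 2).sub (hterm 2 1)
    · exact (hterm 2 0).sub (hterm 0 2)
    · exact (hterm 0 1).sub (hterm 1 0)
  refine ⟨fun x i => ∫ s in (0 : ℝ)..1, g i (x, s),
    contDiffOn_pi.2 fun i => (hg i).contDiffOn_intervalIntegral hW hΩ hUW, fun x hx => ?_⟩
  have hpd (k i : Fin 3) := pd_intervalIntegral hW hΩ hUW (hg i) k hx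
  have hcurl (i : Fin 3) :
      IntervalIntegrable (fun s => curl3 (fun y j => g j (y, s)) x i) volume 0 1 ∧
      curl3 (fun y j => ∫ s in (0 : ℝ)..1, g j (y, s)) x i =
        ∫ s in (0 : ℝ)..1, curl3 (fun y j => g j (y, s)) x i := by
    have hsub (k l a b : Fin 3) := And.intro ((hpd k a).1.sub (hpd l b).1)
      ((congrArg₂ (· - ·) (hpd k a).2 (hpd l b).2).trans
        (intervalIntegral.integral_sub (hpd k a).1 (hpd l b).1).symm)
    fin_cases i
    · exact hsub 1 2 2 1
    · exact hsub 2 0 0 2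
    · exact hsub 0 1 1 0
  ext i
  have hderiv : ∀ s ∈ uIcc (0 : ℝ) 1, HasDerivAt (fun r : ℝ => r ^ 2 * w (x₀ + r • (x - x₀)) i)
      (curl3 (fun y j => g j (y, s)) x i) s := by
    intro s hs
    rw [uIcc_of_le zero_le_one] at hs
    exact hasDerivAt_sq_mul_radial
      (fun i => ((hwi i).differentiableOn one_ne_zero).differentiableAt
        (hΩ.mem_nhds (hstar x hx s hs))) (hdiv _ (hstar x hx s hs)) i
  rw [(hcurl i).2, intervalIntegral.integral_eq_sub_of_hasDerivAt hderiv (hcurl i).1]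
  simp

section TimeDerivative

variable {Ω : Set (Fin 3 → ℝ)} {F : Type*} [NormedAddCommGroup F] [NormedSpace ℝ F]

theorem ContDiffOn.hasDerivAt_time (hΩ : IsOpen Ω) {f : ℝ × (Fin 3 → ℝ) → F}
    (hf : ContDiffOn ℝ 2 f (univ ×ˢ Ω)) (t : ℝ) {x : Fin 3 → ℝ} (hx : x ∈ Ω) :
    HasDerivAt (fun s => f (s, x)) (fderiv ℝ f (t, x) (1, 0)) t := by
  have h := (hf.differentiableOn two_ne_zero).differentiableAt
    ((isOpen_univ.prod hΩ).mem_nhds (mk_mem_prod (mem_univ t) hx))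
  exact h.hasFDerivAt.comp_hasDerivAt t ((hasDerivAt_id t).prodMk (hasDerivAt_const t x))

theorem ContDiffOn.contDiffOn_deriv_time (hΩ : IsOpen Ω) {f : ℝ × (Fin 3 → ℝ) → F}
    (hf : ContDiffOn ℝ 2 f (univ ×ˢ Ω)) (t : ℝ) :
    ContDiffOn ℝ 1 (fun x => deriv (fun s => f (s, x)) t) Ω := by
  have h := (hf.fderiv_of_isOpen (m := 1) (isOpen_univ.prod hΩ) (by norm_num)).clm_apply
    (contDiffOn_const (c := ((1 : ℝ), (0 : Fin 3 → ℝ))))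
  refine (h.comp (g := fun p => fderiv ℝ f p (1, 0)) (f := fun x : Fin 3 → ℝ => (t, x))
    (by fun_prop) fun y hy => mk_mem_prod (mem_univ t) hy).congr fun x hx => ?_
  exact (hf.hasDerivAt_time hΩ t hx).deriv

/-- The time derivative commutes with the spatial partial derivatives. -/
theorem hasDerivAt_pd (hΩ : IsOpen Ω) {f : ℝ × (Fin 3 → ℝ) → ℝ}
    (hf : ContDiffOn ℝ 2 f (univ ×ˢ Ω)) (t : ℝ) {x : Fin 3 → ℝ} (hx : x ∈ Ω) (k : Fin 3) :
    HasDerivAt (fun s => pd k (fun y => f (s, y)) x)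
      (pd k (fun y => deriv (fun s => f (s, y)) t) x) t := by
  have hopen : IsOpen ((univ : Set ℝ) ×ˢ Ω) := isOpen_univ.prod hΩ
  have hmem : (t, x) ∈ (univ : Set ℝ) ×ˢ Ω := ⟨mem_univ t, hx⟩
  have hd2 : HasFDerivAt (fderiv ℝ f) (fderiv ℝ (fderiv ℝ f) (t, x)) (t, x) :=
    (((hf.fderiv_of_isOpen (m := 1) hopen (by norm_num)).differentiableOn
      one_ne_zero).differentiableAt (hopen.mem_nhds hmem)).hasFDerivAt
  have hsymm : IsSymmSndFDerivAt ℝ f (t, x) :=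
    (hf.contDiffAt (hopen.mem_nhds hmem)).isSymmSndFDerivAt (by simp)
  have htime : HasDerivAt (fun s => fderiv ℝ f (s, x) (0, Pi.single k 1))
      (fderiv ℝ (fderiv ℝ f) (t, x) (1, 0) (0, Pi.single k 1)) t := by
    have h := hd2.comp_hasDerivAt t ((hasDerivAt_id t).prodMk (hasDerivAt_const t x))
    simpa using h.clm_apply (hasDerivAt_const t ((0 : ℝ), (Pi.single k 1 : Fin 3 → ℝ)))
  have hspace : pd k (fun y => deriv (fun s => f (s, y)) t) x =
      fderiv ℝ (fderiv ℝ f) (t, x) (0, Pi.single k 1) (1, 0) := by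
    have hcongr : (fun y => deriv (fun s => f (s, y)) t) =ᶠ[𝓝 x]
        fun y => fderiv ℝ f (t, y) (1, 0) := by
      filter_upwards [hΩ.mem_nhds hx] with y hy
      exact (hf.hasDerivAt_time hΩ t hy).deriv
    have h := (hd2.comp x (hasFDerivAt_prodMk_right t x)).clm_apply
      (hasFDerivAt_const ((1 : ℝ), (0 : Fin 3 → ℝ)) x)
    rw [pd, hcongr.fderiv_eq]
    refine (congrArg (fun L => L (Pi.single k 1)) h.fderiv).trans ?_
    simp
  rw [hspace, hsymm.eq]
  refine htime.congr_of_eventuallyEq (.of_forall fun s => ?_)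
  have h := ((hf.differentiableOn two_ne_zero).differentiableAt
    (hopen.mem_nhds ⟨mem_univ s, hx⟩)).hasFDerivAt.comp x (hasFDerivAt_prodMk_right s x)
  refine (congrArg (fun L => L (Pi.single k 1)) h.fderiv).trans ?_
  simp

end TimeDerivative

theorem div3_add {v w : (Fin 3 → ℝ) → (Fin 3 → ℝ)} {x : Fin 3 → ℝ}
    (hv : DifferentiableAt ℝ v x) (hw : DifferentiableAt ℝ w x) :
    div3 (fun y => v y + w y) x = div3 v x + div3 w x := by
  have hpd (k : Fin 3) : pd k (fun y => v y k + w y k) x =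
      pd k (fun y => v y k) x + pd k (fun y => w y k) x := by
    simp only [pd]
    rw [fderiv_fun_add (differentiableAt_pi.1 hv k) (differentiableAt_pi.1 hw k)]
    rfl
  simp only [div3, Pi.add_apply, hpd]
  ring

/-- from Gauss' law `div D = ρ` and charge conservation
`∂ₜ ρ + div j = 0` on a star-shaped open `Ω`, there is a magnetic field `H` with
`curl H(t,·) = ∂ₜ D(t,·) + j(t,·)` on `Ω` for every time `t` (Ampère's law). -/
theorem statement13 (Ω : Set (Fin 3 → ℝ)) (hΩ : IsOpen Ω)
    (x₀ : Fin 3 → ℝ) (hx₀ : x₀ ∈ Ω)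
    (hstar : ∀ x ∈ Ω, ∀ t ∈ Set.Icc (0:ℝ) 1, x₀ + t • (x - x₀) ∈ Ω)
    (D : ℝ → (Fin 3 → ℝ) → (Fin 3 → ℝ))
    (ρ : ℝ → (Fin 3 → ℝ) → ℝ)
    (j : ℝ → (Fin 3 → ℝ) → (Fin 3 → ℝ))
    (hD : ContDiffOn ℝ 2 (fun p : ℝ × (Fin 3 → ℝ) => D p.1 p.2)
      ((Set.univ : Set ℝ) ×ˢ Ω))
    (hρ : ContDiffOn ℝ 1 (fun p : ℝ × (Fin 3 → ℝ) => ρ p.1 p.2)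
      ((Set.univ : Set ℝ) ×ˢ Ω))
    (hj : ContDiffOn ℝ 1 (fun p : ℝ × (Fin 3 → ℝ) => j p.1 p.2)
      ((Set.univ : Set ℝ) ×ˢ Ω))
    (hGauss : ∀ t : ℝ, ∀ x ∈ Ω, div3 (D t) x = ρ t x)
    (hcont : ∀ t : ℝ, ∀ x ∈ Ω, deriv (fun s => ρ s x) t + div3 (j t) x = 0) :
    ∃ H : ℝ → (Fin 3 → ℝ) → (Fin 3 → ℝ), ∀ t : ℝ,
      ContDiffOn ℝ 1 (H t) Ω ∧
      ∀ x ∈ Ω, curl3 (H t) x = deriv (fun s => D s x) t + j t x := by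
  have hcurrent (t : ℝ) : ContDiffOn ℝ 1 (j t) Ω :=
    hj.comp (f := fun x => (t, x)) (by fun_prop) fun x hx => ⟨mem_univ t, hx⟩
  have hdisp (t : ℝ) : ContDiffOn ℝ 1 (fun x => deriv (fun s => D s x) t) Ω :=
    hD.contDiffOn_deriv_time hΩ t
  have hdiv (t : ℝ) : ∀ x ∈ Ω, div3 (fun y => deriv (fun s => D s y) t + j t y) x = 0 := by
    intro x hx
    have hdiff {v : (Fin 3 → ℝ) → (Fin 3 → ℝ)} (hv : ContDiffOn ℝ 1 v Ω) :
        DifferentiableAt ℝ v x :=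
      (hv.differentiableOn one_ne_zero).differentiableAt (hΩ.mem_nhds hx)
    rw [div3_add (hdiff (hdisp t)) (hdiff (hcurrent t)), ← hcont t x hx]
    congr 1
    have hpd (k : Fin 3) : HasDerivAt (fun s => pd k (fun y => D s y k) x)
        (pd k (fun y => deriv (fun s => D s y) t k) x) t := by
      have heq : (fun y => deriv (fun s => D s y) t k) =ᶠ[𝓝 x]
          fun y => deriv (fun s => D s y k) t := by
        filter_upwards [hΩ.mem_nhds hx] with y hy
        have h := (hD.hasDerivAt_time hΩ t hy).differentiableAt
        exact (hasDerivAt_pi.1 h.hasDerivAt k).deriv.symm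
      have h := hasDerivAt_pd hΩ (contDiffOn_pi.1 hD k) t hx k
      rwa [pd, ← heq.fderiv_eq] at h
    have hρdiv : (fun s => ρ s x) = fun s => div3 (D s) x :=
      funext fun s => (hGauss s x hx).symm
    rw [hρdiv]
    exact (((hpd 0).add (hpd 1)).add (hpd 2)).deriv.symm
  choose H hH using fun t =>
    exists_curl3_eq_of_div3_eq_zero hΩ hstar ((hdisp t).add (hcurrent t)) (hdiv t)
  exact ⟨H, hH⟩
end
end
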